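/- For any pure n-qudit state |ψ⟩ (n ≥ 3, d ≥ 2), the entanglement quantity E_T(|ψ⟩) = (d/2)^{n/2} ‖T^{(1⋯n)}‖ − (d(d−1)/2)^{n/2} satisfies E_T(|ψ⟩) ≤ (d/2)^{n/2} [√(d^n − (n/(n−2)) d^{n−2} + 2/(n−2)) − (d−1)^{n/2}]. -/

import Mathlib

open Matrix BigOperators Real

/-- The Kronecker (tensor) product of a finite family of square matrices, given entrywise. -/
def famKron {ι : Type*} [Fintype ι] {dims : ι → ℕ}
    (M : ∀ k, Matrix (Fin (dims k)) (Fin (dims k)) ℂ) :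
    Matrix (∀ k, Fin (dims k)) (∀ k, Fin (dims k)) ℂ :=
  fun a b => ∏ k, M k (a k) (b k)

/-- An orthogonal family of `|n|²` matrices of squared length `c` in the trace form satisfies the
completeness relation. -/
theorem sum_mul_star_of_trace_orthogonal {κ m : Type*} [Fintype κ] [DecidableEq κ] [Fintype m]
    [DecidableEq m] (hcard : Fintype.card κ = Fintype.card (m × m)) (L : κ → Matrix m m ℂ) {c : ℂ}
    (hc : c ≠ 0) (horth : ∀ i j, (L i * (L j)ᴴ).trace = if i = j then c else 0) (b a b' a' : m) :
    ∑ i, L i b a * star (L i b' a') = if a = a' ∧ b = b' then c else 0 := by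
  let U : Matrix κ (m × m) ℂ := Matrix.of fun i p => L i p.1 p.2
  have hU : U * (c⁻¹ • Uᴴ) = 1 := by
    ext i j
    have h := horth i j
    simp only [Matrix.trace, Matrix.diag, Matrix.mul_apply, conjTranspose_apply] at h
    rw [Matrix.mul_smul, Matrix.smul_apply, Matrix.mul_apply, Fintype.sum_prod_type]
    simp only [U, Matrix.of_apply, conjTranspose_apply, h, Matrix.one_apply, smul_eq_mul]
    split_ifs <;> simp [hc]
  have hU' := (Matrix.mul_eq_one_comm_of_card_eq _ _ _ hcard).1 hU
  have h := congrFun (congrFun hU' (b', a')) (b, a)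
  rw [Matrix.smul_mul, Matrix.smul_apply, Matrix.mul_apply, smul_eq_mul,
    inv_mul_eq_iff_eq_mul₀ hc] at h
  simp only [U, Matrix.of_apply, conjTranspose_apply, Matrix.one_apply, Prod.mk.injEq] at h
  simp_rw [mul_comm (L _ b a), h, mul_ite, mul_one, mul_zero]
  congr 1
  simp only [eq_iff_iff]
  tauto

/-- The expectation of the product of the swaps of the two copies of the sites outside `S`, in the
state `ψ ⊗ ψ`. -/
noncomputable def swapExpectation {ι α : Type*} [Fintype ι] [DecidableEq ι] [Fintype α]
    [DecidableEq α] (ψ : (ι → α) → ℂ) (S : Finset ι) : ℂ :=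
  ∑ a, ∑ b', ∑ b, ∑ a', ψ a * star (ψ b) * (star (ψ a') * ψ b') *
    ∏ k, if k ∈ S then (if a k = b k ∧ a' k = b' k then 1 else 0)
      else if a k = a' k ∧ b k = b' k then 1 else 0

theorem swapExpectation_compl {ι α : Type*} [Fintype ι] [DecidableEq ι] [Fintype α]
    [DecidableEq α] (ψ : (ι → α) → ℂ) (S : Finset ι) :
    swapExpectation ψ Sᶜ = swapExpectation ψ S := by
  unfold swapExpectation
  refine Finset.sum_congr rfl fun a _ => Finset.sum_congr rfl fun b' _ => ?_
  rw [Finset.sum_comm]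
  refine Finset.sum_congr rfl fun b _ => Finset.sum_congr rfl fun a' _ => ?_
  congr 1
  · ring
  · refine Finset.prod_congr rfl fun k _ => ?_
    by_cases hk : k ∈ S <;> simp [hk]

theorem swapExpectation_empty {ι α : Type*} [Fintype ι] [DecidableEq ι] [Fintype α]
    [DecidableEq α] (ψ : (ι → α) → ℂ) (hψ : ∑ x, ‖ψ x‖ ^ 2 = 1) :
    swapExpectation ψ ∅ = 1 := by
  have hψ' : ∑ x, ψ x * star (ψ x) = 1 := by
    simp_rw [Complex.star_def, Complex.mul_conj']
    exact_mod_cast hψ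
  have hprod (a b a' b' : ι → α) :
      (∏ k, if a k = a' k ∧ b k = b' k then (1 : ℂ) else 0) =
        if a = a' then if b = b' then 1 else 0 else 0 := by
    rw [Fintype.prod_ite_zero]
    simp only [forall_and, Finset.prod_const_one, funext_iff, ite_and]
  simp only [swapExpectation, Finset.notMem_empty, if_false, hprod, mul_ite, mul_one, mul_zero,
    Finset.sum_ite_eq, Finset.sum_ite_eq', Finset.mem_univ, if_true]
  calc ∑ a, ∑ b, ψ a * star (ψ b) * (star (ψ a) * ψ b)
      = (∑ a, ψ a * star (ψ a)) * ∑ b, ψ b * star (ψ b) := by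
        rw [Finset.sum_mul_sum]
        exact Finset.sum_congr rfl fun a _ => Finset.sum_congr rfl fun b _ => by ring
    _ = 1 := by rw [hψ', mul_one]

theorem norm_sq_trace_vecMulVec_mul_famKron {ι : Type*} [Fintype ι] [DecidableEq ι] {d : ℕ}
    (ψ : (ι → Fin d) → ℂ) (M : ι → Matrix (Fin d) (Fin d) ℂ) :
    ((‖(vecMulVec ψ (star ψ) * famKron (dims := fun _ : ι => d) M).trace‖ ^ 2 : ℝ) : ℂ) =
      ∑ a, ∑ b', ∑ b, ∑ a', ψ a * star (ψ b) * (star (ψ a') * ψ b') *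
        ∏ k, M k (b k) (a k) * star (M k (b' k) (a' k)) := by
  rw [Complex.ofReal_pow, ← Complex.mul_conj']
  simp only [Matrix.trace, Matrix.diag, Matrix.mul_apply, vecMulVec_apply, famKron, Pi.star_apply,
    map_sum, Finset.prod_mul_distrib]
  simp only [Finset.sum_mul]
  simp only [Finset.mul_sum]
  refine Finset.sum_congr rfl fun a _ => ?_
  conv_rhs => rw [Finset.sum_comm]
  refine Finset.sum_congr rfl fun b _ => ?_
  rw [Finset.sum_comm]
  refine Finset.sum_congr rfl fun b' _ => Finset.sum_congr rfl fun a' _ => ?_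
  simp only [map_mul, map_prod, Complex.star_def, Complex.conj_conj]
  ring

theorem sum_piFinset_norm_sq_trace {ι κ : Type*} [Fintype ι] [DecidableEq ι] {d : ℕ}
    (ψ : (ι → Fin d) → ℂ) (L : κ → Matrix (Fin d) (Fin d) ℂ) (t : ι → Finset κ) (S : Finset ι)
    (c e : ℂ)
    (ht : ∀ k ∈ S, ∀ b a b' a', ∑ m ∈ t k, L m b a * star (L m b' a') =
      if a = b ∧ a' = b' then e else 0)
    (ht' : ∀ k ∉ S, ∀ b a b' a', ∑ m ∈ t k, L m b a * star (L m b' a') =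
      if a = a' ∧ b = b' then c else 0) :
    ((∑ i ∈ Fintype.piFinset t, ‖(vecMulVec ψ (star ψ) *
      famKron (dims := fun _ : ι => d) fun k => L (i k)).trace‖ ^ 2 : ℝ) : ℂ) =
      e ^ S.card * c ^ Sᶜ.card * swapExpectation ψ S := by
  have hprod (a b a' b' : ι → Fin d) :
      ∑ i ∈ Fintype.piFinset t, ∏ k, L (i k) (b k) (a k) * star (L (i k) (b' k) (a' k)) =
      e ^ S.card * c ^ Sᶜ.card *
        ∏ k, if k ∈ S then (if a k = b k ∧ a' k = b' k then (1 : ℂ) else 0)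
          else if a k = a' k ∧ b k = b' k then 1 else 0 := by
    rw [← Finset.prod_univ_sum t fun k m => L m (b k) (a k) * star (L m (b' k) (a' k)),
      ← Finset.prod_const, ← Finset.prod_const, ← Finset.prod_mul_prod_compl S,
      ← Finset.prod_mul_prod_compl S (fun k => ite (k ∈ S) _ _), mul_mul_mul_comm,
      ← Finset.prod_mul_distrib, ← Finset.prod_mul_distrib]
    congr 1 <;> refine Finset.prod_congr rfl fun k hk => ?_
    · rw [ht k hk, if_pos hk, mul_ite, mul_one, mul_zero]
    · rw [Finset.mem_compl] at hk
      rw [ht' k hk, if_neg hk, mul_ite, mul_one, mul_zero]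
  rw [Complex.ofReal_sum]
  simp only [norm_sq_trace_vecMulVec_mul_famKron, swapExpectation]
  rw [Finset.sum_comm, Finset.mul_sum]
  refine Finset.sum_congr rfl fun a _ => ?_
  rw [Finset.sum_comm, Finset.mul_sum]
  refine Finset.sum_congr rfl fun b' _ => ?_
  rw [Finset.sum_comm, Finset.mul_sum]
  refine Finset.sum_congr rfl fun b _ => ?_
  rw [Finset.sum_comm, Finset.mul_sum]
  refine Finset.sum_congr rfl fun a' _ => ?_
  rw [← Finset.mul_sum, hprod]
  ring

/-- The linear programming bound: if the weights `w i` of the multi-indices are nonnegative and, for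
each `k`, the weight of those equal to `none` at `k` is `D` times the weight of those equal to
`none` off `k`, then the multi-indices without `none` cannot carry too much weight. -/
theorem sum_nowhere_none_le {n : ℕ} (hn : 3 ≤ n) {κ : Type*} [Fintype κ] [DecidableEq κ]
    (w : (Fin n → Option κ) → ℝ) (hw : ∀ i, 0 ≤ w i) {D : ℝ} (hD : 1 ≤ D)
    (h : ∀ k, (∑ i with i k = none, w i) = D * ∑ i with ∀ j ≠ k, i j = none, w i) :
    ((n : ℝ) - 2) * (∑ i with ∀ k, i k ≠ none, w i) ≤
      ((n : ℝ) - 2) * (∑ i, w i) + (2 - n * D) * w fun _ => none := by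
  have hn' : (3 : ℝ) ≤ n := by exact_mod_cast hn
  have hsum : ∑ i, w i * ∑ k, ((if i k = none then 1 else 0) -
      D * if ∀ j ≠ k, i j = none then 1 else 0) = 0 := by
    simp_rw [Finset.mul_sum]
    rw [Finset.sum_comm]
    refine Finset.sum_eq_zero fun k _ => ?_
    have := h k
    rw [Finset.sum_filter, Finset.sum_filter, Finset.mul_sum] at this
    refine Eq.trans ?_ (sub_eq_zero.2 this)
    rw [← Finset.sum_sub_distrib]
    refine Finset.sum_congr rfl fun i _ => ?_
    split_ifs <;> ring
  have hpt (i : Fin n → Option κ) :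
      ((n : ℝ) - 2) * (if ∀ k, i k ≠ none then 1 else 0) + ∑ k, ((if i k = none then 1 else 0) -
        D * if ∀ j ≠ k, i j = none then 1 else 0) ≤
      ((n : ℝ) - 2) + (2 - n * D) * if i = (fun _ => none) then 1 else 0 := by
    by_cases hall : i = fun _ => none
    · subst hall
      have : ¬ ∀ k : Fin n, (none : Option κ) ≠ none := fun h => h ⟨0, by omega⟩ rfl
      rw [if_neg this]
      simp
    have hz : ∑ k, (if i k = none then (1 : ℝ) else 0) =
        n - ∑ k, if i k ≠ none then (1 : ℝ) else 0 := by
      rw [eq_sub_iff_add_eq, ← Finset.sum_add_distrib, Finset.sum_congr rfl (g := fun _ => (1 : ℝ))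
        fun k _ => by by_cases hk : i k = none <;> simp [hk]]
      simp
    have hy (k : Fin n) : (0 : ℝ) ≤ if ∀ j ≠ k, i j = none then 1 else 0 := by
      split_ifs <;> norm_num
    simp only [if_neg hall, mul_zero, add_zero, Finset.sum_sub_distrib, ← Finset.mul_sum]
    have hy' := Finset.sum_nonneg fun k (_ : k ∈ Finset.univ) => hy k
    by_cases hnone : ∀ k, i k ≠ none
    · have : ∑ k, (if i k = none then (1 : ℝ) else 0) = 0 :=
        Finset.sum_eq_zero fun k _ => if_neg (hnone k)
      rw [if_pos hnone, this]
      nlinarith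
    rw [if_neg hnone, mul_zero, zero_add]
    obtain ⟨k, hk⟩ : ∃ k, i k ≠ none := by
      by_contra! hcon
      exact hall (funext hcon)
    by_cases hone : ∀ j ≠ k, i j = none
    · have h₁ : (1 : ℝ) ≤ ∑ k, if ∀ j ≠ k, i j = none then (1 : ℝ) else 0 := by
        refine le_trans ?_ (Finset.single_le_sum (fun k _ => hy k) (Finset.mem_univ k))
        rw [if_pos hone]
      have h₂ : (1 : ℝ) ≤ ∑ k, if i k ≠ none then (1 : ℝ) else 0 := by
        refine le_trans ?_ (Finset.single_le_sum (fun k _ => by split_ifs <;> norm_num)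
          (Finset.mem_univ k))
        rw [if_pos hk]
      nlinarith
    · push Not at hone
      obtain ⟨j, hjk, hj⟩ := hone
      have h₂ : (2 : ℝ) ≤ ∑ k, if i k ≠ none then (1 : ℝ) else 0 := by
        rw [Finset.sum_boole]
        have : ({j, k} : Finset (Fin n)) ⊆ ({k | i k ≠ none} : Finset (Fin n)) := by
          intro l
          simp only [Finset.mem_insert, Finset.mem_singleton, Finset.mem_filter, Finset.mem_univ,
            true_and]
          rintro (rfl | rfl) <;> assumption
        have := Finset.card_le_card this
        rw [Finset.card_pair hjk] at this
        exact_mod_cast this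
      nlinarith
  calc ((n : ℝ) - 2) * (∑ i with ∀ k, i k ≠ none, w i)
      = ∑ i, w i * (((n : ℝ) - 2) * (if ∀ k, i k ≠ none then 1 else 0) +
          ∑ k, ((if i k = none then 1 else 0) - D * if ∀ j ≠ k, i j = none then 1 else 0)) := by
        simp_rw [mul_add]
        rw [Finset.sum_add_distrib, hsum, add_zero, Finset.sum_filter, Finset.mul_sum]
        refine Finset.sum_congr rfl fun i _ => ?_
        split_ifs <;> ring
    _ ≤ ∑ i, w i * (((n : ℝ) - 2) + (2 - n * D) * if i = (fun _ => none) then 1 else 0) :=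
        Finset.sum_le_sum fun i _ => mul_le_mul_of_nonneg_left (hpt i) (hw i)
    _ = _ := by
        simp_rw [mul_add]
        rw [Finset.sum_add_distrib, ← Finset.sum_mul, mul_comm]
        simp only [mul_ite, mul_one, mul_zero, Finset.sum_ite_eq', Finset.mem_univ, if_true]
        ring

/-- The family `lam` together with the multiple of the identity that has Hilbert-Schmidt norm `√2`. -/
noncomputable def adjoinIdentity {d : ℕ} {κ : Type*} (lam : κ → Matrix (Fin d) (Fin d) ℂ) :
    Option κ → Matrix (Fin d) (Fin d) ℂ
  | none => (Real.sqrt (2 / d) : ℂ) • 1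
  | some i => lam i

theorem adjoinIdentity_none_mul_star {d : ℕ} {κ : Type*} (lam : κ → Matrix (Fin d) (Fin d) ℂ)
    (b a b' a' : Fin d) :
    adjoinIdentity lam none b a * star (adjoinIdentity lam none b' a') =
      if a = b ∧ a' = b' then (2 / d : ℂ) else 0 := by
  have h : (Real.sqrt (2 / d) : ℂ) * Real.sqrt (2 / d) = 2 / d := by
    rw [← Complex.ofReal_mul, Real.mul_self_sqrt (by positivity)]
    norm_num
  simp only [adjoinIdentity, Matrix.smul_apply, Matrix.one_apply, smul_eq_mul, star_mul',
    Complex.star_def, Complex.conj_ofReal]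
  rw [mul_mul_mul_comm, h]
  by_cases h₁ : a = b <;> by_cases h₂ : a' = b' <;> simp [h₁, h₂, Ne.symm]

theorem adjoinIdentity_trace {d : ℕ} (hd : d ≠ 0) {κ : Type*} [DecidableEq κ]
    (lam : κ → Matrix (Fin d) (Fin d) ℂ)
    (hherm : ∀ i, (lam i).IsHermitian)
    (htr0 : ∀ i, (lam i).trace = 0)
    (horth : ∀ i j, (lam i * lam j).trace = if i = j then 2 else 0) (i j : Option κ) :
    (adjoinIdentity lam i * (adjoinIdentity lam j)ᴴ).trace = if i = j then 2 else 0 := by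
  have h : (Real.sqrt (2 / d) : ℂ) * Real.sqrt (2 / d) = 2 / d := by
    rw [← Complex.ofReal_mul, Real.mul_self_sqrt (by positivity)]
    norm_num
  have hd' : (d : ℂ) ≠ 0 := by exact_mod_cast hd
  rcases i with _ | i <;> rcases j with _ | j
  · simp only [adjoinIdentity, conjTranspose_smul, conjTranspose_one, Complex.star_def,
      Complex.conj_ofReal, Matrix.mul_smul, smul_smul, mul_one, h, trace_smul,
      trace_one, Fintype.card_fin, smul_eq_mul, if_true]
    field_simp
  · simp [adjoinIdentity, (hherm j).eq, htr0]
  · simp [adjoinIdentity, htr0]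
  · simp [adjoinIdentity, (hherm j).eq, horth]

theorem sum_norm_sq_trace_le (n d : ℕ) (hn : 3 ≤ n) (hd : 2 ≤ d)
    (ψ : (Fin n → Fin d) → ℂ) (hψ : ∑ x, ‖ψ x‖ ^ 2 = 1)
    (lam : Fin (d ^ 2 - 1) → Matrix (Fin d) (Fin d) ℂ)
    (hherm : ∀ i, (lam i).IsHermitian)
    (htr0 : ∀ i, (lam i).trace = 0)
    (horth : ∀ i j, (lam i * lam j).trace = if i = j then 2 else 0) :
    ∑ i : Fin n → Fin (d ^ 2 - 1), ‖(vecMulVec ψ (star ψ) *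
        famKron (dims := fun _ : Fin n => d) fun k => lam (i k)).trace‖ ^ 2 ≤
      (2 / (d : ℝ)) ^ n * ((d : ℝ) ^ n - ((n : ℝ) / ((n : ℝ) - 2)) * (d : ℝ) ^ (n - 2)
            + 2 / ((n : ℝ) - 2)) := by
  have hn' : (3 : ℝ) ≤ n := by exact_mod_cast hn
  have hd' : (2 : ℝ) ≤ d := by exact_mod_cast hd
  have hd0 : (d : ℝ) ≠ 0 := by positivity
  have hdC : (d : ℂ) ≠ 0 := by exact_mod_cast hd0
  let w : (Fin n → Option (Fin (d ^ 2 - 1))) → ℝ := fun i => ‖(vecMulVec ψ (star ψ) *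
      famKron (dims := fun _ : Fin n => d) fun k => adjoinIdentity lam (i k)).trace‖ ^ 2
  have hZ (S : Finset (Fin n)) : ((∑ i with ∀ k ∈ S, i k = none, w i : ℝ) : ℂ) =
      (2 / d) ^ S.card * 2 ^ Sᶜ.card * swapExpectation ψ S := by
    have hpi : ({i | ∀ k ∈ S, i k = none} : Finset (Fin n → Option (Fin (d ^ 2 - 1)))) =
        Fintype.piFinset fun k => if k ∈ S then {none} else Finset.univ := by
      ext i
      simp only [Finset.mem_filter, Finset.mem_univ, true_and, Fintype.mem_piFinset]
      refine forall_congr' fun k => ?_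
      by_cases hk : k ∈ S <;> simp [hk]
    rw [hpi]
    refine sum_piFinset_norm_sq_trace ψ _ _ S 2 (2 / d) ?_ ?_
    · intro k hk b a b' a'
      rw [if_pos hk, Finset.sum_singleton]
      exact adjoinIdentity_none_mul_star lam b a b' a'
    · intro k hk b a b' a'
      rw [if_neg hk]
      refine sum_mul_star_of_trace_orthogonal ?_ _ two_ne_zero
        (adjoinIdentity_trace (by omega) lam hherm htr0 horth) b a b' a'
      have : 1 ≤ d ^ 2 := Nat.one_le_pow _ _ (by omega)
      simp only [Fintype.card_option, Fintype.card_fin, Fintype.card_prod]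
      rw [Nat.sub_add_cancel this, sq]
  have htotal : ∑ i, w i = 2 ^ n := by
    have := hZ ∅
    simp only [Finset.notMem_empty, false_imp_iff, implies_true, Finset.filter_true,
      swapExpectation_empty ψ hψ, Finset.card_empty, Finset.compl_empty, Finset.card_univ,
      Fintype.card_fin, pow_zero, one_mul, mul_one] at this
    exact_mod_cast this
  have hnone : (w fun _ => none) = (2 / d) ^ n := by
    have := hZ Finset.univ
    have hs : ({i | ∀ k ∈ Finset.univ, i k = none} : Finset (Fin n → Option (Fin (d ^ 2 - 1)))) =
        {fun _ => none} := by
      ext i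
      simp [funext_iff]
    rw [hs, Finset.sum_singleton, ← swapExpectation_compl, Finset.compl_univ,
      swapExpectation_empty ψ hψ] at this
    simp only [Finset.card_empty, Finset.card_univ,
      Fintype.card_fin, pow_zero, mul_one] at this
    exact_mod_cast this
  have hrel (k : Fin n) : (∑ i with i k = none, w i) =
      (d : ℝ) ^ (n - 2) * ∑ i with ∀ j ≠ k, i j = none, w i := by
    have h₁ := hZ {k}
    have h₂ := hZ {k}ᶜ
    rw [swapExpectation_compl, compl_compl] at h₂
    simp only [Finset.mem_singleton, forall_eq, Finset.card_singleton, Finset.card_compl,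
      Fintype.card_fin, Finset.mem_compl] at h₁ h₂
    have h : ((∑ i with i k = none, w i : ℝ) : ℂ) =
        (((d : ℝ) ^ (n - 2) * ∑ i with ∀ j ≠ k, i j = none, w i : ℝ) : ℂ) := by
      rw [Complex.ofReal_mul, h₁, h₂]
      obtain ⟨m, rfl⟩ : ∃ m, n = m + 2 := ⟨n - 2, by omega⟩
      simp only [Nat.add_sub_cancel, show m + 2 - 1 = m + 1 by omega]
      push_cast
      rw [div_pow, div_pow]
      field_simp
      ring
    exact_mod_cast h
  have hN : ∑ i : Fin n → Fin (d ^ 2 - 1), ‖(vecMulVec ψ (star ψ) *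
        famKron (dims := fun _ : Fin n => d) fun k => lam (i k)).trace‖ ^ 2 =
      ∑ i with ∀ k, i k ≠ none, w i := by
    refine Finset.sum_nbij (fun i k => some (i k)) ?_ ?_ ?_ ?_
    · simp
    · intro i _ j _ hij
      funext k
      simpa using congrFun hij k
    · intro i hi
      simp only [Finset.coe_filter, Finset.mem_univ, true_and, Set.mem_ofPred_eq,
        Option.ne_none_iff_exists'] at hi
      choose f hf using hi
      exact ⟨f, by simp, funext fun k => (hf k).symm⟩
    · intro i _
      rfl
  have key := sum_nowhere_none_le hn w (fun i => by positivity)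
    (one_le_pow₀ (by linarith : (1 : ℝ) ≤ d) (n := n - 2)) hrel
  rw [htotal, hnone] at key
  rw [hN]
  have hpos : (0 : ℝ) < n - 2 := by linarith
  rw [← mul_le_mul_iff_right₀ hpos]
  refine key.trans_eq ?_
  rw [div_pow]
  field_simp
  ring

/-- For any pure n-qudit state |ψ⟩ (n ≥ 3, d ≥ 2), the entanglement measure
E_T(|ψ⟩) = (d/2)^{n/2}‖T^{(1⋯n)}‖ − (d(d−1)/2)^{n/2} satisfies
E_T(|ψ⟩) ≤ (d/2)^{n/2}[√(dⁿ − (n/(n−2))d^{n−2} + 2/(n−2)) − (d−1)^{n/2}]. -/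
theorem entanglement_measure_upper_bound (n d : ℕ) (hn : 3 ≤ n) (hd : 2 ≤ d)
    (ψ : (Fin n → Fin d) → ℂ) (hψ : ∑ x, ‖ψ x‖ ^ 2 = 1)
    (lam : Fin (d ^ 2 - 1) → Matrix (Fin d) (Fin d) ℂ)
    (hherm : ∀ i, (lam i).IsHermitian)
    (htr0 : ∀ i, (lam i).trace = 0)
    (horth : ∀ i j, (lam i * lam j).trace = if i = j then 2 else 0) :
    ((d : ℝ) / 2) ^ ((n : ℝ) / 2) *
        Real.sqrt (∑ i : Fin n → Fin (d ^ 2 - 1),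
          ‖(vecMulVec ψ (star ψ) *
              famKron (dims := fun _ : Fin n => d) fun k => lam (i k)).trace‖ ^ 2)
      - ((d : ℝ) * ((d : ℝ) - 1) / 2) ^ ((n : ℝ) / 2)
    ≤ ((d : ℝ) / 2) ^ ((n : ℝ) / 2) *
        (Real.sqrt ((d : ℝ) ^ n - ((n : ℝ) / ((n : ℝ) - 2)) * (d : ℝ) ^ (n - 2)
            + 2 / ((n : ℝ) - 2))
          - ((d : ℝ) - 1) ^ ((n : ℝ) / 2)) := by
  have hn' : (3 : ℝ) ≤ n := by exact_mod_cast hn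
  have hd' : (2 : ℝ) ≤ d := by exact_mod_cast hd
  have hT := sum_norm_sq_trace_le n d hn hd ψ hψ lam hherm htr0 horth
  have hT0 := (Finset.sum_nonneg fun i _ => sq_nonneg _).trans hT
  have hc : 0 < (2 / (d : ℝ)) ^ n := by positivity
  have hQ := nonneg_of_mul_nonneg_right hT0 hc
  have hc1 : (2 / (d : ℝ)) ^ n ≤ 1 :=
    pow_le_one₀ (by positivity) ((div_le_one (by linarith)).2 hd')
  have hfactor : ((d : ℝ) * ((d : ℝ) - 1) / 2) ^ ((n : ℝ) / 2) =
      ((d : ℝ) / 2) ^ ((n : ℝ) / 2) * ((d : ℝ) - 1) ^ ((n : ℝ) / 2) := by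
    rw [← Real.mul_rpow (by positivity) (by linarith)]
    congr 1
    ring
  rw [hfactor, mul_sub]
  gcongr
  exact hT.trans (mul_le_of_le_one_left hQ hc1)
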